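/- Let (P_1,Q_1) and (P_2,Q_2) be pairs of integers with P_1 > 0, P_2 > 0, |Q_1| = |Q_2| = 1, and (P_i,Q_i) not in {(1,1),(2,1)} for i = 1,2. Then the set {U_n(P_1,Q_1) : n >= 0} ∩ {V_m(P_2,Q_2) : m >= 0} is finite. -/

import Mathlib

/-- Lucas sequence of the first kind: `U 0 = 0`, `U 1 = 1`,
`U (n+2) = P * U (n+1) - Q * U n`. -/
def lucasU (P Q : ℤ) : ℕ → ℤ
  | 0 => 0
  | 1 => 1
  | n + 2 => P * lucasU P Q (n + 1) - Q * lucasU P Q n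

/-- Lucas sequence of the second kind: `V 0 = 2`, `V 1 = P`,
`V (n+2) = P * V (n+1) - Q * V n`. -/
def lucasV (P Q : ℤ) : ℕ → ℤ
  | 0 => 2
  | 1 => P
  | n + 2 => P * lucasV P Q (n + 1) - Q * lucasV P Q n

section
open Finset PowerSeries

theorem hasSum_choose_mul_neg_pow (a : ℝ) {x : ℝ} (hx : |x| < 1) :
    HasSum (fun m : ℕ ↦ (-1) ^ m * Ring.choose a m * x ^ m) ((1 - x) ^ a) := by
  have h := (Real.one_add_rpow_hasFPowerSeriesOnBall_zero (a := a)).hasSum (y := -x)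
    (by simpa [enorm_eq_nnnorm, ← NNReal.coe_lt_coe] using hx)
  simp only [binomialSeries_apply, List.ofFn_const, List.prod_replicate, smul_eq_mul, zero_add] at h
  rw [← sub_eq_add_neg] at h
  have h' (m : ℕ) : (-1) ^ m * Ring.choose a m * x ^ m = Ring.choose a m * (-x) ^ m := by
    rw [neg_pow]
    ring
  simpa only [h'] using h

theorem succ_mul_choose_succ (r : ℝ) (h : ℕ) :
    ((h : ℝ) + 1) * Ring.choose r (h + 1) = Ring.choose r h * (r - h) := by
  have := Ring.choose_smul_choose r (Nat.le_succ h)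
  simpa [Nat.choose_symm_of_eq_add] using this

theorem choose_neg_half (h : ℕ) :
    Ring.choose (-1 / 2 : ℝ) h = (-1) ^ h * h.centralBinom / 4 ^ h := by
  induction h with
  | zero => simp
  | succ h ih =>
    have h1 := succ_mul_choose_succ (-1 / 2) h
    have h2 : ((h : ℝ) + 1) * (h + 1).centralBinom = 2 * (2 * h + 1) * h.centralBinom := by
      exact_mod_cast h.succ_mul_centralBinom_succ
    rw [ih] at h1
    have h3 : (h : ℝ) + 1 ≠ 0 := by positivity
    apply mul_left_cancel₀ h3
    rw [h1, pow_succ, pow_succ]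
    field_simp
    linear_combination 2 * h2

/-- `(-1) ^ h * (k - 1/2 choose h)`, the coefficients of `(1 - x) ^ (k - 1/2)`. -/
noncomputable def halfCoeff (k h : ℕ) : ℝ := (-1) ^ h * Ring.choose ((k : ℝ) - 1 / 2) h

theorem halfCoeff_succ_succ (k h : ℕ) :
    halfCoeff (k + 1) (h + 1) = halfCoeff k (h + 1) - halfCoeff k h := by
  have := Ring.choose_succ_succ ((k : ℝ) - 1 / 2) h
  simp only [halfCoeff]
  rw [show ((k + 1 : ℕ) : ℝ) - 1 / 2 = (k : ℝ) - 1 / 2 + 1 by push_cast; ring, this]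
  ring

theorem halfCoeff_zero_right (k : ℕ) : halfCoeff k 0 = 1 := by simp [halfCoeff]

theorem halfCoeff_zero_left (h : ℕ) : halfCoeff 0 h = h.centralBinom / 4 ^ h := by
  have := choose_neg_half h
  simp only [halfCoeff]
  rw [show ((0 : ℕ) : ℝ) - 1 / 2 = -1 / 2 by norm_num, this, ← mul_div_assoc, ← mul_assoc,
    ← mul_pow]
  norm_num

theorem abs_halfCoeff_le (k h : ℕ) : |halfCoeff k h| ≤ 2 ^ k := by
  induction k generalizing h with
  | zero =>
    rw [halfCoeff_zero_left, abs_of_nonneg (by positivity), pow_zero, div_le_one (by positivity)]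
    have := Nat.choose_le_two_pow (2 * h) h
    rw [pow_mul] at this
    exact_mod_cast this
  | succ k ih =>
    cases h with
    | zero => rw [halfCoeff_zero_right, abs_one]; exact one_le_pow₀ (by norm_num)
    | succ h =>
      rw [halfCoeff_succ_succ, pow_succ]
      linarith [abs_sub (halfCoeff k (h + 1)) (halfCoeff k h), ih h, ih (h + 1)]

theorem exists_int_halfCoeff (k h : ℕ) : ∃ z : ℤ, 4 ^ h * halfCoeff k h = z := by
  induction k generalizing h with
  | zero => exact ⟨h.centralBinom, by rw [halfCoeff_zero_left]; push_cast; field_simp⟩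
  | succ k ih =>
    cases h with
    | zero => exact ⟨1, by simp [halfCoeff_zero_right]⟩
    | succ h =>
      obtain ⟨a, ha⟩ := ih (h + 1)
      obtain ⟨b, hb⟩ := ih h
      refine ⟨a - 4 * b, ?_⟩
      rw [halfCoeff_succ_succ]
      push_cast
      linear_combination ha - 4 * hb

theorem succ_mul_halfCoeff_succ (k h : ℕ) :
    ((h : ℝ) + 1) * halfCoeff k (h + 1) = halfCoeff k h * (h - (k - 1 / 2)) := by
  have := succ_mul_choose_succ ((k : ℝ) - 1 / 2) h
  simp only [halfCoeff, pow_succ]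
  linear_combination -(-1) ^ h * this

theorem halfCoeff_sign (k h : ℕ) (hk : k ≤ h) : 0 < (-1) ^ k * halfCoeff k h := by
  have key (h : ℕ) (hk : h ≤ k) : 0 < (-1) ^ h * halfCoeff k h := by
    induction h with
    | zero => simp [halfCoeff_zero_right]
    | succ h ih =>
      have h1 := succ_mul_halfCoeff_succ k h
      have h2 : (h : ℝ) + 1 ≤ k := by exact_mod_cast hk
      have h3 : 0 < ((h : ℝ) + 1) * ((-1) ^ (h + 1) * halfCoeff k (h + 1)) := by
        have := mul_pos (ih (by omega)) (show 0 < (k : ℝ) - 1 / 2 - h by linarith)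
        rw [pow_succ]
        linear_combination this + (-1) ^ h * h1
      exact pos_of_mul_pos_right h3 (by positivity)
  induction h, hk using Nat.le_induction with
  | base => exact key k le_rfl
  | succ h hk ih =>
    have h1 := succ_mul_halfCoeff_succ k h
    have h2 : (k : ℝ) ≤ h := by exact_mod_cast hk
    have h3 : 0 < ((h : ℝ) + 1) * ((-1) ^ k * halfCoeff k (h + 1)) := by
      have := mul_pos ih (show 0 < (h : ℝ) - (k - 1 / 2) by linarith)
      linear_combination this - (-1) ^ k * h1
    exact pos_of_mul_pos_right h3 (by positivity)

theorem one_le_four_pow_mul_halfCoeff (k h : ℕ) (hk : k ≤ h) :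
    1 ≤ 4 ^ h * ((-1) ^ k * halfCoeff k h) := by
  obtain ⟨z, hz⟩ := exists_int_halfCoeff k h
  have h1 := mul_pos (show (0 : ℝ) < 4 ^ h by positivity) (halfCoeff_sign k h hk)
  have h2 : 4 ^ h * ((-1) ^ k * halfCoeff k h) = (((-1) ^ k * z : ℤ) : ℝ) := by
    push_cast
    linear_combination (-1) ^ k * hz
  rw [h2] at h1 ⊢
  exact_mod_cast h1

theorem choose_mul_halfCoeff (k m s : ℕ) :
    halfCoeff k (m + s) * (s + m).choose s =
      halfCoeff k s * ((-1) ^ m * Ring.choose ((k : ℝ) - 1 / 2 - s) m) := by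
  have := Ring.choose_smul_choose ((k : ℝ) - 1 / 2) (Nat.le_add_left s m)
  rw [Nat.add_sub_cancel, nsmul_eq_mul] at this
  rw [add_comm s m, halfCoeff, halfCoeff, pow_add]
  linear_combination (-1) ^ m * (-1) ^ s * this

/-- The geometric power series `∑ u ^ m X ^ m`. -/
noncomputable def geomSeries (u : ℝ) : ℝ⟦X⟧ := PowerSeries.mk (u ^ ·)

theorem coeff_geomSeries_pow (u : ℝ) (s m : ℕ) :
    coeff m (geomSeries u ^ (s + 1)) = (s + m).choose s * u ^ m := by
  have : geomSeries u = rescale u (PowerSeries.mk 1) := by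
    ext; simp [geomSeries]
  rw [this, ← map_pow, mk_one_pow_eq_mk_choose_add, coeff_rescale, coeff_mk, mul_comm]

theorem geomSeries_eq (u : ℝ) : geomSeries u = 1 + C u * X * geomSeries u := by
  ext m
  cases m with
  | zero => simp [geomSeries]
  | succ m =>
    rw [map_add, mul_assoc, coeff_C_mul, coeff_succ_X_mul]
    simp [geomSeries, coeff_one, pow_succ, mul_comm]

theorem coeff_zero_mul_geomSeries (F : ℝ⟦X⟧) (u : ℝ) :
    coeff 0 (F * geomSeries u) = coeff 0 F := by
  simp [geomSeries]

theorem coeff_succ_mul_geomSeries (F : ℝ⟦X⟧) (u : ℝ) (m : ℕ) :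
    coeff (m + 1) (F * geomSeries u) = coeff (m + 1) F + u * coeff m (F * geomSeries u) := by
  conv_lhs => rw [geomSeries_eq, show F * (1 + C u * X * geomSeries u) =
    F + C u * (X * (F * geomSeries u)) by ring, map_add, coeff_C_mul, coeff_succ_X_mul]

/-- The coefficients of `F` are nonnegative and grow at most like `A * (2 * B) ^ m`. -/
def CoeffBound (A B : ℝ) (F : ℝ⟦X⟧) : Prop :=
  ∀ m, 0 ≤ coeff m F ∧ coeff m F ≤ A * (2 * B) ^ m

theorem CoeffBound.mul_geomSeries {A B u : ℝ} {F : ℝ⟦X⟧} (hF : CoeffBound A B F)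
    (hu : 0 ≤ u) (huB : u ≤ B) : CoeffBound (2 * A) B (F * geomSeries u) := by
  intro m
  have hA : 0 ≤ A := by simpa using (hF 0).1.trans (hF 0).2
  have hB : 0 ≤ B := hu.trans huB
  induction m with
  | zero =>
    rw [coeff_zero_mul_geomSeries]
    have := hF 0
    simp only [pow_zero, mul_one] at this ⊢
    exact ⟨this.1, by linarith⟩
  | succ m ih =>
    rw [coeff_succ_mul_geomSeries]
    have := hF (m + 1)
    refine ⟨add_nonneg this.1 (mul_nonneg hu ih.1), ?_⟩
    calc _ ≤ A * (2 * B) ^ (m + 1) + B * (2 * A * (2 * B) ^ m) :=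
          add_le_add this.2 (mul_le_mul huB ih.2 ih.1 hB)
      _ = _ := by ring

theorem CoeffBound.mul_geomSeries_pow {A B u : ℝ} {F : ℝ⟦X⟧} (hF : CoeffBound A B F)
    (hu : 0 ≤ u) (huB : u ≤ B) (e : ℕ) :
    CoeffBound (2 ^ e * A) B (F * geomSeries u ^ e) := by
  induction e with
  | zero => simpa using hF
  | succ e ih =>
    have := ih.mul_geomSeries hu huB
    rwa [mul_assoc, ← pow_succ, ← mul_assoc, ← pow_succ'] at this

/-- The product `∏ j, (1 - u j X) ^ (-e j)`. -/
noncomputable def geomProd (u : Fin 3 → ℝ) (e : Fin 3 → ℕ) : ℝ⟦X⟧ :=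
  ∏ j, geomSeries (u j) ^ e j

theorem geomProd_add_single (u : Fin 3 → ℝ) (e : Fin 3 → ℕ) (i : Fin 3) :
    geomProd u (e + Pi.single i 1) = geomProd u e * geomSeries (u i) := by
  simp only [geomProd, Pi.add_apply, pow_add, Finset.prod_mul_distrib]
  congr 1
  rw [Finset.prod_eq_single i] <;> simp +contextual

theorem geomProd_single (u : Fin 3 → ℝ) (i : Fin 3) (s : ℕ) :
    geomProd u (Pi.single i s) = geomSeries (u i) ^ s := by
  rw [geomProd, Finset.prod_eq_single i] <;> simp +contextual

theorem coeff_zero_geomProd (u : Fin 3 → ℝ) (e : Fin 3 → ℕ) : coeff 0 (geomProd u e) = 1 := by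
  simp [geomProd, geomSeries]

theorem coeffBound_geomProd {B : ℝ} {u : Fin 3 → ℝ} (hu : ∀ j, 0 ≤ u j) (huB : ∀ j, u j ≤ B)
    (e : Fin 3 → ℕ) : CoeffBound (2 ^ ∑ j, e j) B (geomProd u e) := by
  have h1 : CoeffBound 1 B 1 := by
    intro m
    have := (hu 0).trans (huB 0)
    rw [coeff_one]
    split_ifs with h
    · simp [h]
    · exact ⟨le_rfl, by positivity⟩
  have := ((h1.mul_geomSeries_pow (hu 0) (huB 0) (e 0)).mul_geomSeries_pow (hu 1) (huB 1)
    (e 1)).mul_geomSeries_pow (hu 2) (huB 2) (e 2)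
  convert this using 1
  · rw [Fin.sum_univ_three]; ring
  · rw [geomProd, Fin.prod_univ_three]; ring

/-- The pairing of a power series `F` with the coefficients of `(1 - x / N) ^ (k - 1/2)`,
shifted by `s`. For `F = geomProd u e` with `∑ j, e j = s + 1` it is the divided difference of this
function at the nodes `u j` with multiplicities `e j`. -/
noncomputable def pairing (k : ℕ) (N : ℝ) (s : ℕ) (F : ℝ⟦X⟧) : ℝ :=
  ∑' m, halfCoeff k (m + s) / N ^ (m + s) * coeff m F

section pairing

variable {k : ℕ} {A B N : ℝ} {F : ℝ⟦X⟧}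

theorem CoeffBound.abs_pairing_term_le (hF : CoeffBound A B F) (hN : 0 < N) (hB : 0 ≤ B)
    (hNB : 4 * B ≤ N) (s m : ℕ) :
    |halfCoeff k (m + s) / N ^ (m + s) * coeff m F| ≤ 2 ^ k * A / N ^ s * (1 / 2) ^ m := by
  have h1 := hF m
  have hA : 0 ≤ A := by simpa using (hF 0).1.trans (hF 0).2
  have h2 : coeff m F ≤ A * ((1 / 2) ^ m * N ^ m) := by
    refine h1.2.trans (mul_le_mul_of_nonneg_left ?_ hA)
    rw [← mul_pow]
    exact pow_le_pow_left₀ (by positivity) (by linarith) m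
  rw [abs_mul, abs_div, abs_of_nonneg h1.1, abs_of_pos (pow_pos hN _)]
  calc _ ≤ 2 ^ k / N ^ (m + s) * (A * ((1 / 2) ^ m * N ^ m)) := by
        gcongr
        · exact h1.1
        · exact abs_halfCoeff_le _ _
    _ = _ := by
        rw [pow_add]
        field_simp

theorem CoeffBound.summable_pairing (hF : CoeffBound A B F) (hN : 0 < N) (hB : 0 ≤ B)
    (hNB : 4 * B ≤ N) (s : ℕ) :
    Summable fun m ↦ halfCoeff k (m + s) / N ^ (m + s) * coeff m F :=
  .of_norm_bounded (summable_geometric_two.mul_left _)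
    (hF.abs_pairing_term_le hN hB hNB s)

theorem CoeffBound.abs_pairing_le (hF : CoeffBound A B F) (hN : 0 < N) (hB : 0 ≤ B)
    (hNB : 4 * B ≤ N) (s : ℕ) : |pairing k N s F| ≤ 2 ^ k * A / N ^ s * 2 :=
  tsum_of_norm_bounded (f := fun m ↦ halfCoeff k (m + s) / N ^ (m + s) * coeff m F)
    (hasSum_geometric_two.mul_left _)
    (hF.abs_pairing_term_le hN hB hNB s)

theorem CoeffBound.le_abs_pairing (hF : CoeffBound A B F) (hF0 : coeff 0 F = 1) (hN : 0 < N)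
    (hB : 0 ≤ B) (hNB : 4 * B ≤ N) {s : ℕ} (hs : k ≤ s) :
    1 / (4 ^ s * N ^ s) ≤ |pairing k N s F| := by
  have h1 : 1 / (4 ^ s * N ^ s) ≤ (-1) ^ k * pairing k N s F := by
    rw [pairing, ← tsum_mul_left]
    refine le_trans ?_ (((hF.summable_pairing hN hB hNB s).mul_left _).le_tsum 0 fun m _ ↦ ?_)
    · have := one_le_four_pow_mul_halfCoeff k s hs
      rw [hF0, zero_add, mul_one, ← mul_div_assoc, ← div_div]
      gcongr
      rw [div_le_iff₀ (by positivity)]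
      linarith
    · have := halfCoeff_sign k (m + s) (by omega)
      rw [← mul_assoc, ← mul_div_assoc]
      exact mul_nonneg (div_nonneg this.le (by positivity)) (hF m).1
  refine h1.trans ((le_abs_self _).trans_eq ?_)
  simp [abs_mul]

theorem CoeffBound.pairing_succ_mul (hF : CoeffBound A B F) (hN : 0 < N) (hNB : 4 * B ≤ N)
    {a b : ℝ} (ha : 0 ≤ a) (haB : a ≤ B) (hb : 0 ≤ b) (hbB : b ≤ B) (s : ℕ) :
    (b - a) * pairing k N (s + 1) (F * geomSeries a * geomSeries b) =
      pairing k N s (F * geomSeries b) - pairing k N s (F * geomSeries a) := by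
  have hB : 0 ≤ B := ha.trans haB
  have h1 := (hF.mul_geomSeries hb hbB).summable_pairing (k := k) hN hB hNB s
  have h2 := (hF.mul_geomSeries ha haB).summable_pairing (k := k) hN hB hNB s
  have h3 : F * geomSeries b - F * geomSeries a =
      X * (C (b - a) * (F * geomSeries a * geomSeries b)) := by
    have ea := geomSeries_eq a
    have eb := geomSeries_eq b
    rw [map_sub]
    linear_combination F * geomSeries a * eb - F * geomSeries b * ea
  have h4 (m : ℕ) : coeff m (F * geomSeries b) - coeff m (F * geomSeries a) =
      coeff m (X * (C (b - a) * (F * geomSeries a * geomSeries b))) := by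
    rw [← map_sub, h3]
  have h5 := h1.sub h2
  simp only [pairing]
  rw [← h1.tsum_sub h2, ← tsum_mul_left]
  simp only [← mul_sub, h4] at h5 ⊢
  rw [h5.tsum_eq_zero_add, coeff_zero_X_mul, mul_zero, zero_add]
  refine tsum_congr fun m ↦ ?_
  rw [coeff_succ_X_mul, coeff_C_mul, show m + 1 + s = m + (s + 1) by ring]
  ring

end pairing

theorem pairing_geomSeries_pow {K s : ℕ} (hs : s ≤ K) {N u : ℝ} (hN : 0 < N) (hu : 0 ≤ u)
    (huN : u < N) :
    N ^ K * √N * pairing (K + 1) N s (geomSeries u ^ (s + 1)) =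
      halfCoeff (K + 1) s * (N - u) ^ (K - s) * √(N - u) := by
  have hx : |u / N| < 1 := by
    rw [abs_of_nonneg (by positivity)]
    exact (div_lt_one hN).2 huN
  have h1 (m : ℕ) : halfCoeff (K + 1) (m + s) / N ^ (m + s) * coeff m (geomSeries u ^ (s + 1)) =
      halfCoeff (K + 1) s / N ^ s * ((-1) ^ m *
        Ring.choose (((K + 1 : ℕ) : ℝ) - 1 / 2 - s) m * (u / N) ^ m) := by
    have := choose_mul_halfCoeff (K + 1) m s
    rw [coeff_geomSeries_pow, pow_add, div_pow]
    generalize Ring.choose (((K + 1 : ℕ) : ℝ) - 1 / 2 - s) m = c at this ⊢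
    field_simp
    linear_combination u ^ m * this
  have h2 : 0 < 1 - u / N := by linarith [le_abs_self (u / N)]
  have h3 : (1 - u / N) ^ (((K + 1 : ℕ) : ℝ) - 1 / 2 - s) =
      (1 - u / N) ^ (K - s) * √(1 - u / N) := by
    rw [Real.sqrt_eq_rpow, ← Real.rpow_natCast, ← Real.rpow_add h2, Nat.cast_sub hs]
    congr 1
    push_cast
    ring
  have h4 : N - u = N * (1 - u / N) := by field_simp
  rw [pairing, tsum_congr h1, tsum_mul_left, (hasSum_choose_mul_neg_pow _ hx).tsum_eq, h3, h4,
    Real.sqrt_mul hN.le, mul_pow]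
  obtain ⟨d, rfl⟩ := Nat.exists_eq_add_of_le hs
  rw [Nat.add_sub_cancel_left, pow_add]
  field_simp

theorem exists_int_pairing_geomSeries_pow {K s : ℕ} (hs : s ≤ K) {N u : ℤ} (hN : 0 < N)
    (hu : 0 ≤ u) (huN : u < N) :
    ∃ p : ℤ, 4 ^ K * (N ^ K * √N * pairing (K + 1) N s (geomSeries (u : ℝ) ^ (s + 1))) =
      p * √(N - u : ℝ) ∧ |p| ≤ 8 ^ (K + 1) * N ^ K := by
  obtain ⟨z, hz⟩ := exists_int_halfCoeff (K + 1) s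
  have hz' : (4 : ℝ) ^ K * halfCoeff (K + 1) s = 4 ^ (K - s) * z := by
    rw [← hz, ← mul_assoc, ← pow_add, Nat.sub_add_cancel hs]
  refine ⟨4 ^ (K - s) * z * (N - u) ^ (K - s), ?_, ?_⟩
  · rw [pairing_geomSeries_pow hs (by exact_mod_cast hN) (by exact_mod_cast hu)
      (by exact_mod_cast huN)]
    push_cast
    linear_combination ((N : ℝ) - u) ^ (K - s) * √(N - u : ℝ) * hz'
  · have h1 : |4 ^ (K - s) * z| ≤ 8 ^ (K + 1) := by
      have h : |(4 : ℝ) ^ (K - s) * z| ≤ 8 ^ (K + 1) := by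
        rw [← hz', abs_mul, abs_of_pos (by positivity)]
        calc _ ≤ (4 : ℝ) ^ (K + 1) * 2 ^ (K + 1) := by
              gcongr
              · norm_num
              · omega
              · exact abs_halfCoeff_le _ _
          _ = _ := by rw [← mul_pow]; norm_num
      exact_mod_cast h
    rw [abs_mul, abs_of_nonneg (pow_nonneg (by omega : 0 ≤ N - u) _)]
    refine mul_le_mul h1 ?_ (pow_nonneg (by omega) _) (by positivity)
    calc (N - u) ^ (K - s) ≤ N ^ (K - s) := pow_le_pow_left₀ (by omega) (by omega) _
      _ ≤ N ^ K := pow_le_pow_right₀ (by omega) (by omega)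

theorem exists_int_pairing_geomProd (K : ℕ) {N M : ℤ} {u : Fin 3 → ℤ} (hN : 0 < N) (hM : 0 < M)
    (hu : ∀ j, 0 ≤ u j) (huN : ∀ j, 4 * u j ≤ N) (huM : ∀ i j, i ≠ j → u j - u i ∣ M)
    (s : ℕ) (e : Fin 3 → ℕ) (hes : ∑ j, e j = s + 1) (heK : ∀ j, e j ≤ K + 1) :
    ∃ p : Fin 3 → ℤ, (M : ℝ) ^ s * 4 ^ K * (N ^ K * √N *
        pairing (K + 1) N s (geomProd (fun j ↦ (u j : ℝ)) e)) = ∑ j, p j * √(N - u j : ℝ) ∧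
      ∀ j, |p j| ≤ (2 * M) ^ s * 8 ^ (K + 1) * N ^ K := by
  have hN' : (0 : ℝ) < N := by exact_mod_cast hN
  have hu' (j) : (0 : ℝ) ≤ u j := by exact_mod_cast hu j
  have huB (j) : (u j : ℝ) ≤ N / 4 := by
    have : (4 : ℝ) * u j ≤ N := by exact_mod_cast huN j
    linarith
  induction s using Nat.strong_induction_on generalizing e with
  | h s ih =>
  obtain ⟨i, hi⟩ : ∃ i, 0 < e i := by
    by_contra! h
    simp_all
  by_cases hij : ∃ j, i ≠ j ∧ 0 < e j
  · obtain ⟨j, hij, hj⟩ := hij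
    obtain ⟨e, rfl⟩ : ∃ e' : Fin 3 → ℕ,
        e = e' + (Pi.single i 1 : Fin 3 → ℕ) + (Pi.single j 1 : Fin 3 → ℕ) := by
      refine ⟨e - (Pi.single i 1 : Fin 3 → ℕ) - (Pi.single j 1 : Fin 3 → ℕ), funext fun l ↦ ?_⟩
      simp only [Pi.add_apply, Pi.sub_apply, Pi.single_apply]
      grind
    simp only [Pi.add_apply, Finset.sum_add_distrib, Finset.sum_pi_single', Finset.mem_univ,
      if_true] at hes heK
    obtain ⟨s, rfl⟩ : ∃ s', s = s' + 1 := ⟨s - 1, by omega⟩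
    obtain ⟨p, hp, hpb⟩ := ih s (by omega) (e + Pi.single j 1)
      (by simp [Finset.sum_add_distrib]; omega)
      (fun l ↦ by have := heK l; simp only [Pi.add_apply]; omega)
    obtain ⟨q, hq, hqb⟩ := ih s (by omega) (e + Pi.single i 1)
      (by simp [Finset.sum_add_distrib]; omega)
      (fun l ↦ by have := heK l; simp only [Pi.add_apply]; omega)
    obtain ⟨d, hd⟩ := huM i j hij
    have hdM : |d| ≤ M := by
      have h0 : d ≠ 0 := by rintro rfl; omega
      exact Int.le_of_dvd hM ((abs_dvd _ _).2 ⟨u j - u i, by rw [hd]; ring⟩)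
    have hd' : (M : ℝ) = (u j - u i) * d := by exact_mod_cast hd
    have key := (coeffBound_geomProd hu' huB e).pairing_succ_mul (k := K + 1) hN' (by linarith)
      (hu' i) (huB i) (hu' j) (huB j) s
    simp only [geomProd_add_single] at hp hq ⊢
    refine ⟨fun l ↦ d * (p l - q l), ?_, fun l ↦ ?_⟩
    · have h1 : ∑ l, ((d * (p l - q l) : ℤ) : ℝ) * √(N - u l : ℝ) =
          d * (∑ l, p l * √(N - u l : ℝ) - ∑ l, q l * √(N - u l : ℝ)) := by
        rw [← Finset.sum_sub_distrib, Finset.mul_sum]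
        refine Finset.sum_congr rfl fun l _ ↦ ?_
        push_cast
        ring
      rw [h1, ← hp, ← hq, pow_succ]
      nth_rewrite 2 [hd']
      linear_combination (M : ℝ) ^ s * 4 ^ K * N ^ K * √N * d * key
    · rw [abs_mul]
      calc _ ≤ M * ((2 * M) ^ s * 8 ^ (K + 1) * N ^ K + (2 * M) ^ s * 8 ^ (K + 1) * N ^ K) := by
            gcongr
            exact (abs_sub _ _).trans (add_le_add (hpb l) (hqb l))
        _ = _ := by ring
  · push Not at hij
    obtain rfl : e = Pi.single i (s + 1) := by
      have h0 (j) (h : j ≠ i) : e j = 0 := Nat.le_zero.1 (hij j h.symm)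
      rw [Finset.sum_eq_single i (fun j _ h ↦ h0 j h) (by simp)] at hes
      funext j
      by_cases h : j = i
      · subst h; simp [hes]
      · simp [h, h0]
    obtain ⟨p, hp, hpb⟩ := exists_int_pairing_geomSeries_pow (K := K) (s := s) (u := u i)
      (by simpa using heK i) hN (hu i) (by have := huN i; have := hu i; omega)
    refine ⟨Pi.single i (M ^ s * p), ?_, fun l ↦ ?_⟩
    · rw [geomProd_single, mul_assoc, hp, Finset.sum_eq_single i (by simp +contextual) (by simp)]
      simp [mul_assoc]
    · have h1 : M ^ s * |p| ≤ (2 * M) ^ s * 8 ^ (K + 1) * N ^ K := by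
        rw [mul_assoc]
        refine mul_le_mul (pow_le_pow_left₀ hM.le (by omega) s) hpb (abs_nonneg p) (by positivity)
      by_cases h : l = i
      · subst h
        rwa [Pi.single_eq_same, abs_mul, abs_of_pos (pow_pos hM s)]
      · rw [Pi.single_eq_of_ne h, abs_zero]
        exact le_trans (by positivity) h1

/-- Small integral linear forms in three square roots `√(N - u j)`. -/
theorem exists_small_linear_form (u : Fin 3 → ℤ) (hu : ∀ j, 0 ≤ u j) (hinj : u.Injective) :
    ∃ c : ℤ, 1 ≤ c ∧ ∀ N : ℤ, 0 < N → (∀ j, 4 * u j ≤ N) → ∀ k : ℕ, 0 < k →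
      ∃ p : Fin 3 → ℤ, (∀ j, |p j| ≤ c ^ k * N ^ k) ∧
        1 ≤ |∑ j, p j * √(N - u j : ℝ)| * (c ^ k * N ^ (2 * k)) ∧
        |∑ j, p j * √(N - u j : ℝ)| * N ^ (2 * k) ≤ c ^ k * N := by
  obtain ⟨M, hM, huM⟩ : ∃ M : ℤ, 0 < M ∧ ∀ i j, i ≠ j → u j - u i ∣ M := by
    refine ⟨∏ i, ∏ j, if i = j then 1 else |u j - u i|, ?_, fun i j hij ↦ ?_⟩
    · refine Finset.prod_pos fun i _ ↦ Finset.prod_pos fun j _ ↦ ?_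
      split_ifs with h
      · norm_num
      · exact abs_pos.2 (sub_ne_zero.2 fun h' ↦ h (hinj h').symm)
    · rw [← abs_dvd]
      have h1 := Finset.dvd_prod_of_mem (fun j ↦ if i = j then 1 else |u j - u i|)
        (Finset.mem_univ j)
      simp only [if_neg hij] at h1
      exact h1.trans (Finset.dvd_prod_of_mem
        (fun i ↦ ∏ j, if i = j then 1 else |u j - u i|) (Finset.mem_univ i))
  have hM1 : (1 : ℝ) ≤ M := by exact_mod_cast hM
  refine ⟨128 * M ^ 3, by have := pow_pos hM 3; omega, fun N hN huN k hk ↦ ?_⟩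
  obtain ⟨K, rfl⟩ : ∃ K, k = K + 1 := ⟨k - 1, by omega⟩
  obtain ⟨p, hp, hpb⟩ := exists_int_pairing_geomProd K hN hM hu huN huM (3 * K + 2)
    (fun _ ↦ K + 1) (by simp; ring) (fun _ ↦ le_rfl)
  have hN' : (1 : ℝ) ≤ N := by exact_mod_cast hN
  have hN0 : (0 : ℝ) < N := by linarith
  have hF := coeffBound_geomProd (u := fun j ↦ (u j : ℝ)) (B := N / 4)
    (fun j ↦ by exact_mod_cast hu j)
    (fun j ↦ by
      have : (4 : ℝ) * u j ≤ N := by exact_mod_cast huN j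
      linarith) (fun _ ↦ K + 1)
  have hlow := hF.le_abs_pairing (k := K + 1) (s := 3 * K + 2) (coeff_zero_geomProd _ _) hN0
    (by positivity) (by linarith) (by omega)
  have hup := hF.abs_pairing_le (k := K + 1) hN0 (by positivity) (by linarith) (3 * K + 2)
  have hsqrt1 : 1 ≤ √(N : ℝ) := Real.one_le_sqrt.2 hN'
  have hsqrt2 : √(N : ℝ) ≤ N := Real.sqrt_le_self_iff.2 (Or.inr hN')
  have habs : |∑ j, p j * √(N - u j : ℝ)| = M ^ (3 * K + 2) * 4 ^ K * (N ^ K * √N *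
      |pairing (K + 1) N (3 * K + 2) (geomProd (fun j ↦ (u j : ℝ)) fun _ ↦ K + 1)|) := by
    rw [← hp, abs_mul, abs_of_nonneg (by positivity : (0 : ℝ) ≤ M ^ (3 * K + 2) * 4 ^ K), abs_mul,
      abs_of_nonneg (by positivity : 0 ≤ (N : ℝ) ^ K * √N)]
  generalize pairing (K + 1) N (3 * K + 2) (geomProd (fun j ↦ (u j : ℝ)) fun _ ↦ K + 1) = D
    at hlow hup habs
  refine ⟨p, fun j ↦ (hpb j).trans ?_, ?_, ?_⟩
  · calc (2 * M) ^ (3 * K + 2) * 8 ^ (K + 1) * N ^ K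
        ≤ (2 * M) ^ (3 * (K + 1)) * 8 ^ (K + 1) * N ^ (K + 1) := by
          gcongr <;> omega
      _ = (64 * M ^ 3) ^ (K + 1) * N ^ (K + 1) := by
          rw [pow_mul, ← mul_pow]; ring_nf
      _ ≤ _ := by gcongr; norm_num
  · rw [habs]
    push_cast
    calc (1 : ℝ) = 1 * 1 * (N ^ K * 1 * (1 / (4 ^ (3 * K + 2) * N ^ (3 * K + 2)))) *
          (4 ^ (3 * K + 2) * N ^ (2 * (K + 1))) := by
          rw [show 3 * K + 2 = K + 2 * (K + 1) by ring, pow_add (N : ℝ) K]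
          field_simp
      _ ≤ _ := by
          gcongr
          · exact one_le_pow₀ hM1
          · exact one_le_pow₀ (by norm_num)
          · calc (4 : ℝ) ^ (3 * K + 2) ≤ 4 ^ (3 * (K + 1)) := by
                  gcongr
                  · norm_num
                  · omega
              _ = 64 ^ (K + 1) := by rw [pow_mul]; norm_num
              _ ≤ _ := by
                  gcongr
                  linarith [one_le_pow₀ hM1 (n := 3)]
  · rw [habs]
    push_cast
    have hsum : ∑ _j : Fin 3, (K + 1) = 3 * (K + 1) := by simp
    rw [hsum] at hup
    calc _ ≤ M ^ (3 * (K + 1)) * 4 ^ (K + 1) * (N ^ K * N *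
          (2 ^ (K + 1) * 2 ^ (3 * (K + 1)) / N ^ (3 * K + 2) * 2)) * (N : ℝ) ^ (2 * (K + 1)) := by
          gcongr
          · omega
          · norm_num
          · omega
      _ = (M ^ 3) ^ (K + 1) * (64 ^ (K + 1) * 2) * N := by
          rw [show 3 * K + 2 = K + 2 * (K + 1) by ring, pow_add (N : ℝ) K, pow_mul, pow_mul 2,
            show (64 : ℝ) = 4 * 2 * 2 ^ 3 by norm_num, mul_pow, mul_pow]
          field_simp
      _ ≤ (M ^ 3) ^ (K + 1) * (64 ^ (K + 1) * 2 ^ (K + 1)) * N := by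
          gcongr
          exact le_self_pow₀ (by norm_num) (by omega)
      _ = _ := by
          rw [← mul_pow, ← mul_pow]
          ring_nf

theorem mul_abs_sub_le_of_sq_sub_sq {x a b r : ℝ} (hxa : x ≤ a) (ha : 0 ≤ a) (hb : 0 ≤ b)
    (h : |a ^ 2 - b ^ 2| ≤ r) : x * |a - b| ≤ r :=
  calc x * |a - b| ≤ (a + b) * |a - b| := by gcongr; linarith
    _ = |a ^ 2 - b ^ 2| := by rw [sq_sub_sq, abs_mul, abs_of_nonneg (add_nonneg ha hb)]
    _ ≤ r := h

/-- A small integral linear form in `x₀ √D₁`, `y₀`, `z₀ √D₁ √D₂` is very small: multiplied by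
`x √D₁` it is close to an integer, which has to vanish. -/
theorem sq_mul_abs_linear_form_le {D₁ D₂ x₀ y₀ z₀ x y z p q r : ℤ} {C H : ℝ} (hD₁ : 1 ≤ D₁)
    (hD₂ : 1 ≤ D₂) (hy₀ : 0 ≤ y₀) (hz₀ : 0 ≤ z₀) (hx : 0 < x) (hy : 0 ≤ y) (hz : 0 ≤ z)
    (hxy : |y ^ 2 - D₁ * x ^ 2| = 4) (hxz : |D₂ * z ^ 2 - x ^ 2| = 4)
    (hq : |(q : ℝ)| ≤ H) (hr : |(r : ℝ)| ≤ H) (hC : 4 * (y₀ + z₀ * D₁ * D₂) ≤ C)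
    (hHx : 2 * (H * C) < x)
    (hlin : 2 * (x * D₁ * |p * (x₀ * √D₁) + q * y₀ + r * (z₀ * √D₁ * √D₂)|) < 1) :
    x ^ 2 * |p * (x₀ * √D₁) + q * y₀ + r * (z₀ * √D₁ * √D₂)| ≤ H * C := by
  have hD₁' : (1 : ℝ) ≤ D₁ := by exact_mod_cast hD₁
  have hD₂' : (1 : ℝ) ≤ D₂ := by exact_mod_cast hD₂
  have hx' : (0 : ℝ) < x := by exact_mod_cast hx
  have hy' : (0 : ℝ) ≤ y := by exact_mod_cast hy
  have hz' : (0 : ℝ) ≤ z := by exact_mod_cast hz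
  have hy₀' : (0 : ℝ) ≤ y₀ := by exact_mod_cast hy₀
  have hz₀' : (0 : ℝ) ≤ z₀ := by exact_mod_cast hz₀
  have hA1 : 1 ≤ √(D₁ : ℝ) := Real.one_le_sqrt.2 hD₁'
  have hB1 : 1 ≤ √(D₂ : ℝ) := Real.one_le_sqrt.2 hD₂'
  have hA : √(D₁ : ℝ) ^ 2 = D₁ := Real.sq_sqrt (by linarith)
  have hB : √(D₂ : ℝ) ^ 2 = D₂ := Real.sq_sqrt (by linarith)
  have hAD : √(D₁ : ℝ) ≤ D₁ := by nlinarith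
  have hxy' : |(y : ℝ) ^ 2 - D₁ * x ^ 2| = 4 := by exact_mod_cast hxy
  have hxz' : |(D₂ : ℝ) * z ^ 2 - x ^ 2| = 4 := by exact_mod_cast hxz
  have happ₁ : x * |x * √D₁ - y| ≤ 4 := by
    apply mul_abs_sub_le_of_sq_sub_sq _ (by positivity) hy'
    · rw [← hxy', abs_sub_comm (_ ^ 2), mul_pow, hA, mul_comm (D₁ : ℝ)]
    · nlinarith
  have happ₂ : x * |x * √D₂ - D₂ * z| ≤ 4 * D₂ := by
    apply mul_abs_sub_le_of_sq_sub_sq _ (by positivity) (by positivity)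
    · have h : (x * √D₂) ^ 2 - (D₂ * z) ^ 2 = -(D₂ * z ^ 2 - x ^ 2) * (D₂ : ℝ) := by
        rw [mul_pow, hB]
        ring
      rw [h, abs_mul, abs_neg, hxz', abs_of_pos (by linarith)]
    · nlinarith
  set Λ : ℝ := p * (x₀ * √D₁) + q * y₀ + r * (z₀ * √D₁ * √D₂) with hΛ
  have hH : 0 ≤ H := (abs_nonneg _).trans hq
  set I : ℤ := p * x₀ * D₁ * x + q * y₀ * y + r * z₀ * D₁ * D₂ * z with hI
  have hdiff : x * √D₁ * Λ - I =
      q * y₀ * (x * √D₁ - y) + r * (z₀ * D₁) * (x * √D₂ - D₂ * z) := by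
    rw [hΛ, hI]
    push_cast
    linear_combination (p * x₀ * x + r * z₀ * x * √D₂ : ℝ) * hA
  have hclose : x * |x * √D₁ * Λ - I| ≤ H * C :=
    calc x * |x * √D₁ * Λ - I|
        ≤ x * (|(q : ℝ)| * y₀ * |x * √D₁ - y| + |(r : ℝ)| * (z₀ * D₁) * |x * √D₂ - D₂ * z|) := by
          rw [hdiff]
          gcongr
          refine (abs_add_le _ _).trans (le_of_eq ?_)
          rw [abs_mul, abs_mul, abs_mul, abs_mul (r : ℝ), abs_of_nonneg hy₀',
            abs_of_nonneg (by positivity : 0 ≤ (z₀ : ℝ) * D₁)]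
      _ = |(q : ℝ)| * y₀ * (x * |x * √D₁ - y|) +
            |(r : ℝ)| * (z₀ * D₁) * (x * |x * √D₂ - D₂ * z|) := by ring
      _ ≤ H * y₀ * 4 + H * (z₀ * D₁) * (4 * D₂) := by gcongr
      _ = H * (4 * (y₀ + z₀ * D₁ * D₂)) := by ring
      _ ≤ H * C := by gcongr
  have hI0 : I = 0 := by
    apply Int.abs_lt_one_iff.1
    have h1 : |x * √D₁ * Λ - I| < 1 / 2 := by
      have : x * |x * √D₁ * Λ - I| < x * (1 / 2) := by linarith
      exact lt_of_mul_lt_mul_left this hx'.le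
    have h2 : |x * √D₁ * Λ| < 1 / 2 := by
      rw [abs_mul, abs_of_nonneg (by positivity)]
      have : x * √D₁ * |Λ| ≤ x * D₁ * |Λ| := by gcongr
      linarith
    have h3 : |(I : ℝ)| < 1 := by
      rw [abs_lt] at *
      constructor <;> linarith [h1.1, h1.2, h2.1, h2.2]
    exact_mod_cast h3
  rw [hI0, Int.cast_zero, sub_zero, abs_mul, abs_of_nonneg (by positivity)] at hclose
  calc x ^ 2 * |Λ| = x * (x * 1 * |Λ|) := by ring
    _ ≤ x * (x * √D₁ * |Λ|) := by gcongr
    _ ≤ H * C := hclose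

theorem exists_exponent {x c N C D : ℝ} (hc : 1 ≤ c) (hC : 1 ≤ C) (hD : 1 ≤ D)
    (hN : 2 * c ^ 4 ≤ N) {k₀ : ℕ} (hk₀ : 0 < k₀) (hk₀N : 16 * D ^ 2 * C ^ 2 * c ^ 2 * N ^ 5 < 2 ^ k₀)
    (hxk₀ : 4 * C ^ 2 * c ^ (2 * k₀) * N ^ (3 * k₀) < x ^ 2) :
    ∃ k : ℕ, 0 < k ∧ 4 * C ^ 2 * c ^ (2 * k) * N ^ (3 * k) < x ^ 2 ∧
      2 * (x * D * (c ^ k * N)) < N ^ (2 * k) := by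
  have hc4 : 1 ≤ c ^ 4 := one_le_pow₀ hc
  have hN0 : 0 < N := by linarith
  have hN2 : 2 ≤ N := by linarith
  have hbig : ∃ k, ¬ 4 * C ^ 2 * c ^ (2 * (k₀ + k)) * N ^ (3 * (k₀ + k)) < x ^ 2 := by
    obtain ⟨n, hn⟩ := pow_unbounded_of_one_lt (x ^ 2) (by linarith : 1 < N)
    refine ⟨n, not_lt.2 (hn.le.trans ?_)⟩
    calc N ^ n ≤ N ^ (3 * (k₀ + n)) := by
          gcongr
          · linarith
          · omega
      _ = 1 * 1 * N ^ (3 * (k₀ + n)) := by ring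
      _ ≤ _ := by
          gcongr
          · nlinarith
          · exact one_le_pow₀ hc
  classical
  obtain ⟨j, hj⟩ : ∃ j, Nat.find hbig = j + 1 :=
    Nat.exists_eq_succ_of_ne_zero fun h ↦ by simpa [h] using (Nat.find_eq_zero hbig).1 h |>.elim hxk₀
  have hlt := not_not.1 (Nat.find_min hbig (m := j) (by omega))
  have hge := not_lt.1 (Nat.find_spec hbig)
  rw [hj, ← add_assoc] at hge
  refine ⟨k₀ + j, by omega, hlt, ?_⟩
  generalize hk : k₀ + j = k at *
  have hkN : 16 * D ^ 2 * C ^ 2 * c ^ 2 * N ^ 5 < 2 ^ k :=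
    hk₀N.trans_le (pow_le_pow_right₀ (by norm_num) (by omega))
  apply lt_of_pow_lt_pow_left₀ 2 (by positivity)
  calc (2 * (x * D * (c ^ k * N))) ^ 2 = 4 * D ^ 2 * c ^ (2 * k) * N ^ 2 * x ^ 2 := by ring
    _ ≤ 4 * D ^ 2 * c ^ (2 * k) * N ^ 2 *
          (4 * C ^ 2 * c ^ (2 * (k + 1)) * N ^ (3 * (k + 1))) := by gcongr
    _ = 16 * D ^ 2 * C ^ 2 * c ^ 2 * N ^ 5 * ((c ^ 4) ^ k * N ^ (3 * k)) := by ring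
    _ < 2 ^ k * ((c ^ 4) ^ k * N ^ (3 * k)) := by gcongr
    _ = (2 * c ^ 4) ^ k * N ^ (3 * k) := by rw [mul_pow]; ring
    _ ≤ N ^ k * N ^ (3 * k) := by gcongr
    _ = (N ^ (2 * k)) ^ 2 := by ring

theorem Int.finite_setOf_of_bddAbove {p : ℤ → Prop} (hp : ∀ x, p x → p (-x))
    (h : ∃ b : ℤ, ∀ x, 0 < x → p x → x ≤ b) : {x | p x}.Finite := by
  obtain ⟨b, hb⟩ := h
  refine (Set.finite_Icc (-max b 0) (max b 0)).subset fun x hx ↦ ?_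
  rcases lt_trichotomy x 0 with hx0 | rfl | hx0
  · have := hb (-x) (by omega) (hp x hx)
    constructor <;> omega
  · constructor <;> omega
  · have := hb x hx0 hx
    constructor <;> omega

/-- The simultaneous Pell equations `y² - D₁ x² = 4 s₁`, `x² - D₂ z² = 4 s₂` have only finitely
many solutions. -/
theorem finite_simultaneous_pell {D₁ D₂ s₁ s₂ : ℤ} (hD₁ : 2 ≤ D₁) (hD₂ : 1 ≤ D₂)
    (hs₁ : |s₁| = 1) (hs₂ : |s₂| = 1) :
    {x : ℤ | ∃ y z : ℤ, y ^ 2 = D₁ * x ^ 2 + 4 * s₁ ∧ D₂ * z ^ 2 = x ^ 2 - 4 * s₂}.Finite := by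
  have hs₁' : s₁ = 1 ∨ s₁ = -1 := eq_or_eq_neg_of_abs_eq hs₁
  have hs₂' : s₂ = 1 ∨ s₂ = -1 := eq_or_eq_neg_of_abs_eq hs₂
  obtain ⟨c, hc1, hc⟩ := exists_small_linear_form
    ![4 * D₁ + 4, 4 * D₁ + 4 - 4 * s₁, 4 * D₁ + 4 + 4 * s₂ * D₁]
    (by
      simp only [Fin.forall_fin_succ]
      rcases hs₁' with rfl | rfl <;> rcases hs₂' with rfl | rfl <;> simp <;> omega)
    (by
      intro i j
      fin_cases i <;> fin_cases j <;> simp <;>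
        rcases hs₁' with rfl | rfl <;> rcases hs₂' with rfl | rfl <;> omega)
  apply Int.finite_setOf_of_bddAbove (fun x ↦ by simp)
  by_contra! hunb
  obtain ⟨x₀, hx₀pos, ⟨y₀, z₀, hy₀, hz₀⟩, hx₀⟩ := hunb (2 * c ^ 4 + 40 * D₁ + 40)
  have hNpos : 0 < D₁ * x₀ ^ 2 + (4 * D₁ + 4) := by positivity
  have hxN : x₀ ≤ D₁ * x₀ ^ 2 := by nlinarith
  have hN : 2 * c ^ 4 ≤ D₁ * x₀ ^ 2 + (4 * D₁ + 4) := by linarith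
  have hc4 : 0 ≤ c ^ 4 := by positivity
  replace hc := hc (D₁ * x₀ ^ 2 + (4 * D₁ + 4)) hNpos (by
    simp only [Fin.forall_fin_succ]
    rcases hs₁' with rfl | rfl <;> rcases hs₂' with rfl | rfl <;> simp <;>
      refine ⟨?_, ?_, ?_⟩ <;> linarith)
  have hsq₀ : √(((D₁ * x₀ ^ 2 + (4 * D₁ + 4) : ℤ) : ℝ) - ((4 * D₁ + 4 : ℤ) : ℝ)) = x₀ * √D₁ := by
    rw [← Int.cast_sub, add_sub_cancel_right, Int.cast_mul, Int.cast_pow, mul_comm,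
      Real.sqrt_mul (by positivity), Real.sqrt_sq (by exact_mod_cast hx₀pos.le)]
  have hsq₁ : √(((D₁ * x₀ ^ 2 + (4 * D₁ + 4) : ℤ) : ℝ) - ((4 * D₁ + 4 - 4 * s₁ : ℤ) : ℝ)) =
      (|y₀| : ℤ) := by
    rw [← Int.cast_sub, show D₁ * x₀ ^ 2 + (4 * D₁ + 4) - (4 * D₁ + 4 - 4 * s₁) = |y₀| ^ 2 by
      rw [sq_abs]; linarith, Int.cast_pow, Real.sqrt_sq (by positivity)]
  have hsq₂ : √(((D₁ * x₀ ^ 2 + (4 * D₁ + 4) : ℤ) : ℝ) -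
      ((4 * D₁ + 4 + 4 * s₂ * D₁ : ℤ) : ℝ)) = (|z₀| : ℤ) * √D₁ * √D₂ := by
    rw [← Int.cast_sub, show D₁ * x₀ ^ 2 + (4 * D₁ + 4) - (4 * D₁ + 4 + 4 * s₂ * D₁) =
      |z₀| ^ 2 * D₁ * D₂ by rw [sq_abs]; linear_combination -D₁ * hz₀, Int.cast_mul, Int.cast_mul,
      Int.cast_pow, Real.sqrt_mul (by positivity), Real.sqrt_mul (by positivity),
      Real.sqrt_sq (by positivity)]
  simp only [Fin.sum_univ_three, Matrix.cons_val, hsq₀, hsq₁, hsq₂] at hc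
  clear hsq₀ hsq₁ hsq₂
  generalize D₁ * x₀ ^ 2 + (4 * D₁ + 4) = N at *
  set C : ℤ := 4 * (|y₀| + |z₀| * D₁ * D₂) + 1 with hC
  have hC1 : 1 ≤ C := by
    have : 0 ≤ 4 * (|y₀| + |z₀| * D₁ * D₂) := by positivity
    omega
  obtain ⟨k₀, hk₀⟩ := pow_unbounded_of_one_lt
    (16 * (D₁ : ℝ) ^ 2 * C ^ 2 * c ^ 2 * N ^ 5) one_lt_two
  replace hk₀ : 16 * (D₁ : ℝ) ^ 2 * C ^ 2 * c ^ 2 * N ^ 5 < 2 ^ (k₀ + 1) :=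
    hk₀.trans_le (pow_le_pow_right₀ one_le_two k₀.le_succ)
  obtain ⟨x, hxpos, ⟨y, z, hy, hz⟩, hx⟩ :=
    hunb (4 * C ^ 2 * c ^ (2 * (k₀ + 1)) * N ^ (3 * (k₀ + 1)))
  have hc1' : (1 : ℝ) ≤ c := by exact_mod_cast hc1
  have hC1' : (1 : ℝ) ≤ C := by exact_mod_cast hC1
  have hD₁' : (1 : ℝ) ≤ D₁ := by exact_mod_cast (by omega : 1 ≤ D₁)
  have hx0' : (0 : ℝ) < x := by exact_mod_cast hxpos
  have hN0' : (0 : ℝ) < N := by exact_mod_cast hNpos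
  obtain ⟨k, hk, hkx, hkN⟩ := exists_exponent (x := (x : ℝ)) hc1' hC1' hD₁'
    (by exact_mod_cast hN) (Nat.add_one_pos k₀) hk₀ (by
      exact_mod_cast hx.trans_le (le_self_pow₀ (by omega : 1 ≤ x) two_ne_zero))
  obtain ⟨p, hp, hlow, hup⟩ := hc k hk
  have hp' (j : Fin 3) : |(p j : ℝ)| ≤ (c : ℝ) ^ k * N ^ k := by exact_mod_cast hp j
  have hN1' : (1 : ℝ) ≤ N := by exact_mod_cast (by omega : 1 ≤ N)
  have hHx : 2 * ((c : ℝ) ^ k * N ^ k * C) < x := by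
    apply lt_of_pow_lt_pow_left₀ 2 hx0'.le
    calc (2 * ((c : ℝ) ^ k * N ^ k * C)) ^ 2 = (4 : ℝ) * (C : ℝ) ^ 2 * c ^ (2 * k) * N ^ (2 * k) := by ring
      _ ≤ (4 : ℝ) * (C : ℝ) ^ 2 * c ^ (2 * k) * N ^ (3 * k) := by gcongr; omega
      _ < (x : ℝ) ^ 2 := hkx
  have key := sq_mul_abs_linear_form_le (D₁ := D₁) (D₂ := D₂) (x₀ := x₀) (y₀ := |y₀|) (z₀ := |z₀|)
    (x := x) (y := |y|) (z := |z|) (p := p 0) (q := p 1) (r := p 2) (C := C) (by omega) hD₂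
    (abs_nonneg _) (abs_nonneg _) hxpos (abs_nonneg _) (abs_nonneg _)
    (by rw [sq_abs, hy]; rcases hs₁' with rfl | rfl <;> simp)
    (by rw [sq_abs, hz]; rcases hs₂' with rfl | rfl <;> simp)
    (hp' 1) (hp' 2) (by rw [hC]; push_cast; linarith) hHx
    (by
      apply lt_of_mul_lt_mul_right _ (by positivity : 0 ≤ (N : ℝ) ^ (2 * k))
      rw [one_mul]
      refine lt_of_le_of_lt ?_ hkN
      rw [mul_assoc 2, mul_assoc]
      gcongr)
  generalize |(p 0 : ℝ) * (x₀ * √D₁) + p 1 * (|y₀| : ℤ) + p 2 * ((|z₀| : ℤ) * √D₁ * √D₂)| = Λ at *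
  have hle : (x : ℝ) ^ 2 ≤ C * c ^ (2 * k) * N ^ (3 * k) :=
    calc (x : ℝ) ^ 2 = x ^ 2 * 1 := by ring
      _ ≤ x ^ 2 * (Λ * (c ^ k * N ^ (2 * k))) := by gcongr
      _ = x ^ 2 * Λ * (c ^ k * N ^ (2 * k)) := by ring
      _ ≤ c ^ k * N ^ k * C * (c ^ k * N ^ (2 * k)) := by gcongr
      _ = _ := by ring
  have hlt : (C : ℝ) * c ^ (2 * k) * N ^ (3 * k) ≤ 4 * C ^ 2 * c ^ (2 * k) * N ^ (3 * k) := by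
    gcongr
    nlinarith
  linarith

end

theorem lucas_succ (P Q : ℤ) (n : ℕ) :
    2 * lucasU P Q (n + 1) = P * lucasU P Q n + lucasV P Q n ∧
      2 * lucasV P Q (n + 1) = (P ^ 2 - 4 * Q) * lucasU P Q n + P * lucasV P Q n := by
  induction n using Nat.twoStepInduction with
  | zero => simp [lucasU, lucasV, mul_comm]
  | one => constructor <;> simp [lucasU, lucasV] <;> ring
  | more n h₁ h₂ =>
    rw [lucasU.eq_3 P Q (n + 1), lucasV.eq_3 P Q (n + 1)]
    constructor
    · rw [lucasU.eq_3 P Q n, lucasV.eq_3 P Q n] at *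
      linear_combination P * h₂.1 - Q * h₁.1
    · rw [lucasU.eq_3 P Q n, lucasV.eq_3 P Q n] at *
      linear_combination P * h₂.2 - Q * h₁.2

theorem lucasV_sq (P Q : ℤ) (n : ℕ) :
    lucasV P Q n ^ 2 = (P ^ 2 - 4 * Q) * lucasU P Q n ^ 2 + 4 * Q ^ n := by
  induction n with
  | zero => simp [lucasU, lucasV]
  | succ n ih =>
    obtain ⟨hU, hV⟩ := lucas_succ P Q n
    apply mul_left_cancel₀ (four_ne_zero (α := ℤ))
    linear_combination (2 * lucasV P Q (n + 1) +
        ((P ^ 2 - 4 * Q) * lucasU P Q n + P * lucasV P Q n)) * hV -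
      (P ^ 2 - 4 * Q) * (2 * lucasU P Q (n + 1) + (P * lucasU P Q n + lucasV P Q n)) * hU +
      4 * Q * ih

theorem five_le_lucas_discr {P Q : ℤ} (hP : 0 < P) (hQ : |Q| = 1)
    (hnd : (P, Q) ≠ (1, 1) ∧ (P, Q) ≠ (2, 1)) : 5 ≤ P ^ 2 - 4 * Q := by
  rcases eq_or_eq_neg_of_abs_eq hQ with rfl | rfl
  · simp only [ne_eq, Prod.mk.injEq, and_true] at hnd
    have : 3 ≤ P := by omega
    nlinarith
  · nlinarith

theorem UV_intersection_finite (P₁ Q₁ P₂ Q₂ : ℤ)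
    (hP₁ : 0 < P₁) (hP₂ : 0 < P₂) (hQ₁ : |Q₁| = 1) (hQ₂ : |Q₂| = 1)
    (hnd₁ : (P₁, Q₁) ≠ (1, 1) ∧ (P₁, Q₁) ≠ (2, 1))
    (hnd₂ : (P₂, Q₂) ≠ (1, 1) ∧ (P₂, Q₂) ≠ (2, 1)) :
    ({x : ℤ | ∃ n : ℕ, x = lucasU P₁ Q₁ n} ∩
      {x : ℤ | ∃ m : ℕ, x = lucasV P₂ Q₂ m}).Finite := by
  have hD₁ := five_le_lucas_discr hP₁ hQ₁ hnd₁
  have hD₂ := five_le_lucas_discr hP₂ hQ₂ hnd₂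
  have hS : {s : ℤ | |s| = 1}.Finite :=
    (Set.finite_Icc (-1) 1).subset fun s hs ↦ abs_le.1 (le_of_eq hs)
  refine (hS.biUnion fun s₁ hs₁ ↦ hS.biUnion fun s₂ hs₂ ↦
    finite_simultaneous_pell (by omega : 2 ≤ P₁ ^ 2 - 4 * Q₁) (by omega : 1 ≤ P₂ ^ 2 - 4 * Q₂)
      hs₁ hs₂).subset ?_
  rintro x ⟨⟨n, hn⟩, m, hm⟩
  simp only [Set.mem_iUnion]
  refine ⟨Q₁ ^ n, by simp [abs_pow, hQ₁], Q₂ ^ m, by simp [abs_pow, hQ₂], lucasV P₁ Q₁ n,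
    lucasU P₂ Q₂ m, ?_, ?_⟩
  · rw [hn, lucasV_sq]
  · rw [hm, lucasV_sq]
    ring
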